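/- Let A be a set with |A| ≥ 3 and let α₁, …, α_k ∈ Quo(A) be antisymmetric quasiorders (i.e., partial orders on A). If {α₁, …, α_k} generates Quo(A) as a complete involution lattice, then {α₁ \ Δ_A, …, α_k \ Δ_A} (where Δ_A is the equality relation on A) generates Tran(A) as a complete involution lattice. -/

import Mathlib

universe u

open Set

/-- The diagonal (equality) relation on `α`, as a set of pairs. -/
def diagRel (α : Type u) : Set (α × α) := {p | p.1 = p.2}

/-- A quasiorder (preorder): a reflexive and transitive binary relation, as a set of pairs. -/
def IsQuoRel {α : Type u} (r : Set (α × α)) : Prop :=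
  (∀ a : α, (a, a) ∈ r) ∧ ∀ a b c : α, (a, b) ∈ r → (b, c) ∈ r → (a, c) ∈ r

/-- A transitive binary relation, as a set of pairs. -/
def IsTranRel {α : Type u} (r : Set (α × α)) : Prop :=
  ∀ a b c : α, (a, b) ∈ r → (b, c) ∈ r → (a, c) ∈ r

/-- An equivalence relation, as a set of pairs. -/
def IsEquRel {α : Type u} (r : Set (α × α)) : Prop :=
  IsQuoRel r ∧ ∀ p : α × α, p ∈ r → (p.2, p.1) ∈ r

/-- `Quo(α)`: the set of all quasiorders on `α`. -/
def QuoRels (α : Type u) : Set (Set (α × α)) := {r | IsQuoRel r}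

/-- `Tran(α)`: the set of all transitive relations on `α`. -/
def TranRels (α : Type u) : Set (Set (α × α)) := {r | IsTranRel r}

/-- `Equ(α)`: the set of all equivalence relations on `α`. -/
def EquRels (α : Type u) : Set (Set (α × α)) := {r | IsEquRel r}

/-- The least quasiorder containing `r` (the reflexive-transitive closure of `r`). -/
def quoGen {α : Type u} (r : Set (α × α)) : Set (α × α) := ⋂₀ {s | IsQuoRel s ∧ r ⊆ s}

/-- The least transitive relation containing `r` (the transitive closure of `r`). -/
def tranGen {α : Type u} (r : Set (α × α)) : Set (α × α) := ⋂₀ {s | IsTranRel s ∧ r ⊆ s}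

/-- The least equivalence relation containing `r`. -/
def equGen {α : Type u} (r : Set (α × α)) : Set (α × α) := ⋂₀ {s | IsEquRel s ∧ r ⊆ s}

/-- `quo(a,b)`: the least quasiorder containing the pair `(a,b)`. -/
def quoPair {α : Type u} (a b : α) : Set (α × α) := quoGen {(a, b)}

/-- `equ(a,b)`: the least equivalence relation containing the pair `(a,b)`. -/
def equPair {α : Type u} (a b : α) : Set (α × α) := equGen {(a, b)}

/-- The involution: the inverse of a relation. -/
def invRel {α : Type u} (r : Set (α × α)) : Set (α × α) := {p | (p.2, p.1) ∈ r}

/-- `T` is closed under arbitrary (possibly infinite, possibly empty) joins and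
meets of the complete lattice `Quo(α)`: the meet of a family of quasiorders is its
intersection and the join is the quasiorder generated by its union. -/
def QuoClosed {α : Type u} (T : Set (Set (α × α))) : Prop :=
  (∀ S ⊆ T, quoGen (⋃₀ S) ∈ T) ∧ (∀ S ⊆ T, ⋂₀ S ∈ T)

/-- `X` generates the complete lattice `Quo(α)` in the complete sense. -/
def QuoGenerates {α : Type u} (X : Set (Set (α × α))) : Prop :=
  X ⊆ QuoRels α ∧ ∀ T ⊆ QuoRels α, X ⊆ T → QuoClosed T → T = QuoRels α

/-- `T` is closed under arbitrary joins and meets of the complete lattice `Tran(α)`. -/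
def TranClosed {α : Type u} (T : Set (Set (α × α))) : Prop :=
  (∀ S ⊆ T, tranGen (⋃₀ S) ∈ T) ∧ (∀ S ⊆ T, ⋂₀ S ∈ T)

/-- `X` generates the complete lattice `Tran(α)` in the complete sense. -/
def TranGenerates {α : Type u} (X : Set (Set (α × α))) : Prop :=
  X ⊆ TranRels α ∧ ∀ T ⊆ TranRels α, X ⊆ T → TranClosed T → T = TranRels α

/-- `X` generates `Quo(α)` as a complete involution lattice. -/
def QuoInvGenerates {α : Type u} (X : Set (Set (α × α))) : Prop :=
  X ⊆ QuoRels α ∧ ∀ T ⊆ QuoRels α, X ⊆ T → QuoClosed T →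
    (∀ r ∈ T, invRel r ∈ T) → T = QuoRels α

/-- `X` generates `Tran(α)` as a complete involution lattice. -/
def TranInvGenerates {α : Type u} (X : Set (Set (α × α))) : Prop :=
  X ⊆ TranRels α ∧ ∀ T ⊆ TranRels α, X ⊆ T → TranClosed T →
    (∀ r ∈ T, invRel r ∈ T) → T = TranRels α

/-- Incomparability (with respect to inclusion). -/
def Incomp {α : Type u} (a b : Set (α × α)) : Prop := ¬ a ⊆ b ∧ ¬ b ⊆ a

/-- The complete lattice `Quo(α)` is `(1+1+2)`-generated: it is generated, in the
complete sense, by a four-element set `{x₁,x₂,x₃,x₄}` with `x₁ < x₂` such that both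
`{x₁,x₃,x₄}` and `{x₂,x₃,x₄}` are antichains. -/
def QuoOneOneTwoGenerated (α : Type u) : Prop :=
  ∃ x₁ x₂ x₃ x₄ : Set (α × α),
    x₁ ⊂ x₂ ∧ Incomp x₁ x₃ ∧ Incomp x₁ x₄ ∧ Incomp x₂ x₃ ∧ Incomp x₂ x₄ ∧
    Incomp x₃ x₄ ∧ QuoGenerates {x₁, x₂, x₃, x₄}

/-- A cardinal is accessible: it is finite, or it is infinite and every cardinal
`lam ≤ κ` satisfies `lam ≤ 2 ^ μ` for some `μ < lam`, or is at most a sum of fewer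
than `lam` many cardinals each smaller than `lam`. -/
def AccessibleCard (κ : Cardinal.{u}) : Prop :=
  κ < Cardinal.aleph0 ∨
    (Cardinal.aleph0 ≤ κ ∧ ∀ lam : Cardinal.{u}, lam ≤ κ →
      (∃ μ : Cardinal.{u}, μ < lam ∧ lam ≤ 2 ^ μ) ∨
      ∃ (ι : Type u) (f : ι → Cardinal.{u}),
        Cardinal.mk ι < lam ∧ (∀ i : ι, f i < lam) ∧ lam ≤ Cardinal.sum f)
lemma subset_tranGen {α : Type u} (r : Set (α × α)) : r ⊆ tranGen r :=
  fun _ hp _ hs => hs.2 hp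

lemma tranGen_subset {α : Type u} {r s : Set (α × α)} (hs : IsTranRel s) (h : r ⊆ s) :
    tranGen r ⊆ s :=
  fun _ hp => hp s ⟨hs, h⟩

lemma isTranRel_tranGen {α : Type u} (r : Set (α × α)) : IsTranRel (tranGen r) :=
  fun x y z hxy hyz s hs => hs.1 x y z (hxy s hs) (hyz s hs)

lemma subset_quoGen {α : Type u} (r : Set (α × α)) : r ⊆ quoGen r :=
  fun _ hp _ hs => hs.2 hp

lemma quoGen_subset {α : Type u} {r s : Set (α × α)} (hs : IsQuoRel s) (h : r ⊆ s) :
    quoGen r ⊆ s :=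
  fun _ hp => hp s ⟨hs, h⟩

lemma isQuoRel_quoGen {α : Type u} (r : Set (α × α)) : IsQuoRel (quoGen r) :=
  ⟨fun x _ hs => hs.1.1 x, fun x y z hxy hyz s hs => hs.1.2 x y z (hxy s hs) (hyz s hs)⟩

lemma isQuoRel_sInter {α : Type u} {S : Set (Set (α × α))} (hS : S ⊆ QuoRels α) :
    IsQuoRel (⋂₀ S) :=
  ⟨fun x _ hs => (hS hs).1 x,
    fun x y z hxy hyz s hs => (hS hs).2 x y z (hxy s hs) (hyz s hs)⟩

lemma isQuoRel_univ {α : Type u} : IsQuoRel (univ : Set (α × α)) :=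
  ⟨fun _ => trivial, fun _ _ _ _ _ => trivial⟩

lemma IsQuoRel.invRel {α : Type u} {r : Set (α × α)} (hr : IsQuoRel r) : IsQuoRel (invRel r) :=
  ⟨hr.1, fun x y z hxy hyz => hr.2 z y x hyz hxy⟩

/-- Adding the diagonal to a transitive relation yields a quasiorder. -/
lemma IsTranRel.union_diagRel {α : Type u} {r : Set (α × α)} (hr : IsTranRel r) :
    IsQuoRel (r ∪ diagRel α) := by
  refine ⟨fun x => Or.inr rfl, ?_⟩
  rintro x y z (hxy | hxy) hyz
  · rcases hyz with hyz | hyz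
    · exact Or.inl (hr x y z hxy hyz)
    · obtain rfl : y = z := hyz
      exact Or.inl hxy
  · obtain rfl : x = y := hxy
    exact hyz

lemma isTranRel_singleton {α : Type u} {x y : α} : IsTranRel {(x, y)} := by
  intro a b c hab hbc
  simp only [mem_singleton_iff, Prod.mk.injEq] at *
  exact ⟨hab.1, hbc.2⟩

/-- The relations obtained by adding the diagonal to the members of a complete sublattice of
`Tran(α)` form a complete sublattice of `Quo(α)`. -/
lemma TranClosed.quoClosed_image {α : Type u} {T : Set (Set (α × α))}
    (hc : TranClosed T) : QuoClosed ((· ∪ diagRel α) '' T) := by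
  constructor <;> intro S hS
  · refine ⟨tranGen (⋃₀ {r ∈ T | r ∪ diagRel α ∈ S}), hc.1 _ fun r hr => hr.1, ?_⟩
    apply Subset.antisymm
    · have hq := isQuoRel_quoGen (⋃₀ S)
      refine union_subset (tranGen_subset hq.2 ?_) ?_
      · rintro p ⟨r, hr, hp⟩
        exact subset_quoGen _ ⟨_, hr.2, Or.inl hp⟩
      · rintro ⟨x, y⟩ (rfl : x = y)
        exact hq.1 x
    · refine quoGen_subset (isTranRel_tranGen _).union_diagRel ?_
      rintro p ⟨q, hq, hp⟩
      obtain ⟨r, hr, rfl⟩ := hS hq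
      exact hp.imp_left fun hp => subset_tranGen _ ⟨r, ⟨hr, hq⟩, hp⟩
  · refine ⟨⋂₀ {r ∈ T | r ∪ diagRel α ∈ S}, hc.2 _ fun r hr => hr.1, ?_⟩
    apply Subset.antisymm
    · rintro p hp q hq
      obtain ⟨r, hr, rfl⟩ := hS hq
      exact hp.imp_left fun hp => hp r ⟨hr, hq⟩
    · intro p hp
      by_cases hd : p ∈ diagRel α
      · exact Or.inr hd
      · exact Or.inl fun r hr => (hp _ hr.2).resolve_right hd

/-- If `X` generates `Quo(α)` and all members of `X` are below an equivalence relation `e`, then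
`e` is the full relation. -/
lemma QuoInvGenerates.mem_of_isEquRel {α : Type u} {X : Set (Set (α × α))}
    (hX : QuoInvGenerates X) {e : Set (α × α)} (he : IsEquRel e) (hXe : ∀ r ∈ X, r ⊆ e)
    (x y : α) : (x, y) ∈ e := by
  by_cases hxy : x = y
  · exact hxy ▸ he.1.1 x
  have key : {q | IsQuoRel q ∧ (q = univ ∨ q ⊆ e)} = QuoRels α := by
    refine hX.2 _ (fun q hq => hq.1) (fun q hq => ⟨hX.1 hq, Or.inr (hXe q hq)⟩) ⟨?_, ?_⟩ ?_
    · intro S hS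
      refine ⟨isQuoRel_quoGen _, ?_⟩
      by_cases hu : univ ∈ S
      · exact Or.inl (univ_subset_iff.1 ((subset_sUnion_of_mem hu).trans (subset_quoGen _)))
      · refine Or.inr (quoGen_subset he.1 (sUnion_subset fun q hq => ?_))
        exact (hS hq).2.resolve_left fun h => hu (h ▸ hq)
    · intro S hS
      refine ⟨isQuoRel_sInter fun q hq => (hS hq).1, ?_⟩
      by_cases hu : ∃ q ∈ S, q ≠ univ
      · obtain ⟨q, hq, hne⟩ := hu
        exact Or.inr ((sInter_subset_of_mem hq).trans ((hS hq).2.resolve_left hne))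
      · push Not at hu
        exact Or.inl (sInter_eq_univ.2 hu)
    · rintro q ⟨hq, rfl | hqe⟩
      · exact ⟨hq.invRel, Or.inl rfl⟩
      · exact ⟨hq.invRel, Or.inr fun p hp => he.2 _ (hqe hp)⟩
  have hmem : ({(x, y)} ∪ diagRel α : Set (α × α)) ∈ QuoRels α :=
    isTranRel_singleton.union_diagRel
  rw [← key] at hmem
  rcases hmem.2 with h | h
  · have hyx : (y, x) ∈ ({(x, y)} ∪ diagRel α : Set (α × α)) := h ▸ mem_univ _
    rcases hyx with hyx | hyx
    · exact absurd (congrArg Prod.snd hyx) hxy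
    · exact absurd (Eq.symm hyx) hxy
  · exact h (Or.inl rfl)

/-- A family of transitive relations closed under joins and containing all singletons
consists of all transitive relations. -/
lemma TranClosed.eq_tranRels {α : Type u} {T : Set (Set (α × α))} (hT : T ⊆ TranRels α)
    (hc : TranClosed T) (h : ∀ x y : α, {(x, y)} ∈ T) : T = TranRels α := by
  refine hT.antisymm fun r hr => ?_
  have hjoin : tranGen (⋃₀ ((fun p => {p}) '' r)) ∈ T := by
    refine hc.1 _ ?_
    rintro _ ⟨⟨x, y⟩, -, rfl⟩
    exact h x y
  have hU : ⋃₀ ((fun p => ({p} : Set (α × α))) '' r) = r := by simp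
  rw [hU] at hjoin
  rwa [(tranGen_subset hr Subset.rfl).antisymm (subset_tranGen r)] at hjoin

lemma TranClosed.inter_mem {α : Type u} {T : Set (Set (α × α))} (hc : TranClosed T)
    {r s : Set (α × α)} (hr : r ∈ T) (hs : s ∈ T) : r ∩ s ∈ T := by
  rw [← sInter_pair]
  exact hc.2 _ (pair_subset hr hs)

lemma TranClosed.sup_mem {α : Type u} {T : Set (Set (α × α))} (hc : TranClosed T)
    {r s : Set (α × α)} (hr : r ∈ T) (hs : s ∈ T) : tranGen (r ∪ s) ∈ T := by
  rw [← sUnion_pair]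
  exact hc.1 _ (pair_subset hr hs)

/-- A loop is the meet of two joins of a pair and its inverse, so the singletons of
off-diagonal pairs yield all singletons when there are at least three elements. -/
lemma TranClosed.singleton_loop_mem {α : Type u} {T : Set (Set (α × α))} (hc : TranClosed T)
    (h : ∀ x y : α, x ≠ y → {(x, y)} ∈ T) {x y z : α} (hyx : y ≠ x) (hzx : z ≠ x)
    (hzy : z ≠ y) : {(x, x)} ∈ T := by
  have hbox : ∀ w, tranGen ({(x, w)} ∪ {(w, x)}) ⊆ ({x, w} ×ˢ {x, w} : Set (α × α)) := by
    intro w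
    refine tranGen_subset (fun a b c hab hbc => ⟨hab.1, hbc.2⟩) ?_
    rintro p (rfl | rfl) <;> simp
  have hloop : ∀ w, (x, x) ∈ tranGen ({(x, w)} ∪ {(w, x)}) := fun w =>
    isTranRel_tranGen _ x w x (subset_tranGen _ (Or.inl rfl)) (subset_tranGen _ (Or.inr rfl))
  convert hc.inter_mem (hc.sup_mem (h x y hyx.symm) (h y x hyx))
    (hc.sup_mem (h x z hzx.symm) (h z x hzx)) using 1
  apply Subset.antisymm
  · rintro p rfl
    exact ⟨hloop y, hloop z⟩
  · rintro ⟨a, b⟩ ⟨h₁, h₂⟩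
    have := hbox y h₁
    have := hbox z h₂
    simp only [mem_prod, mem_insert_iff, mem_singleton_iff, Prod.mk.injEq] at *
    grind

/-- If every off-diagonal pair is the only off-diagonal pair of some member of `T`, then the
off-diagonal pairs whose singletons lie in `T` form, with the diagonal, an equivalence. -/
lemma TranClosed.isEquRel_singleton_mem {α : Type u} {T : Set (Set (α × α))}
    (hc : TranClosed T) (hinv : ∀ r ∈ T, invRel r ∈ T)
    (h : ∀ x y : α, ∃ r ∈ T, r ∪ diagRel α = {(x, y)} ∪ diagRel α) :
    IsEquRel {p : α × α | p.1 = p.2 ∨ {p} ∈ T} := by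
  refine ⟨⟨fun x => Or.inl rfl, ?_⟩, ?_⟩
  · rintro x y z (hxy | hxy) (hyz | hyz)
    · exact Or.inl (hxy.trans hyz)
    · obtain rfl : x = y := hxy
      exact Or.inr hyz
    · obtain rfl : y = z := hyz
      exact Or.inr hxy
    · by_cases hxz : x = z
      · exact Or.inl hxz
      by_cases hxy' : x = y
      · exact Or.inr (hxy' ▸ hyz)
      by_cases hyz' : y = z
      · exact Or.inr (hyz' ▸ hxy)
      obtain ⟨r, hr, hrd⟩ := h x z
      have hsub : tranGen ({(x, y)} ∪ {(y, z)}) ⊆ ({(x, y), (y, z), (x, z)} : Set (α × α)) := by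
        refine tranGen_subset ?_ ?_
        · intro a b c hab hbc
          simp only [mem_insert_iff, mem_singleton_iff, Prod.mk.injEq] at *
          grind
        · rintro p (rfl | rfl) <;> simp
      refine Or.inr ?_
      convert hc.inter_mem (hc.sup_mem hxy hyz) hr using 1
      apply Subset.antisymm
      · rintro p rfl
        refine ⟨isTranRel_tranGen _ x y z (subset_tranGen _ (Or.inl rfl))
          (subset_tranGen _ (Or.inr rfl)), ?_⟩
        have : (x, z) ∈ r ∪ diagRel α := hrd ▸ Or.inl rfl
        exact this.resolve_right hxz
      · rintro p ⟨hp, hpr⟩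
        have hp' : p ∈ ({(x, z)} ∪ diagRel α : Set (α × α)) := hrd ▸ Or.inl hpr
        refine hp'.resolve_right fun hd => ?_
        rcases hsub hp with rfl | rfl | rfl
        exacts [hxy' hd, hyz' hd, hxz hd]
  · rintro ⟨x, y⟩ (hxy | hxy)
    · exact Or.inl hxy.symm
    · refine Or.inr ?_
      convert hinv _ hxy using 1
      ext ⟨a, b⟩
      simp [invRel, and_comm]

/-- If `|A| ≥ 3` and `α₁, …, α_k` are antisymmetric quasiorders (partial orders) on `A`
generating `Quo(A)` as a complete involution lattice, then the relations `αᵢ \ Δ_A`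
generate `Tran(A)` as a complete involution lattice. -/
theorem tran_inv_generated_of_quo_inv_generated {α : Type u} (h3 : 3 ≤ Cardinal.mk α)
    (k : ℕ) (a : Fin k → Set (α × α))
    (hquo : ∀ i : Fin k, IsQuoRel (a i))
    (hanti : ∀ i : Fin k, ∀ p : α × α, p ∈ a i → (p.2, p.1) ∈ a i → p.1 = p.2)
    (hgen : QuoInvGenerates (Set.range a)) :
    TranInvGenerates (Set.range fun i : Fin k => a i \ diagRel α) := by
  have hdiff : ∀ i, a i \ diagRel α ∪ diagRel α = a i := fun i => by
    rw [sdiff_union_self, union_eq_left]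
    rintro ⟨x, y⟩ (rfl : x = y)
    exact (hquo i).1 x
  refine ⟨?_, fun T hT hXT hc hinv => hc.eq_tranRels hT ?_⟩
  · rintro _ ⟨i, rfl⟩ x y z ⟨hxy, hne⟩ ⟨hyz, -⟩
    refine ⟨(hquo i).2 x y z hxy hyz, fun hxz => hne ?_⟩
    obtain rfl : x = z := hxz
    exact hanti i (x, y) hxy hyz
  have himage : (· ∪ diagRel α) '' T = QuoRels α := by
    refine hgen.2 _ ?_ ?_ (hc.quoClosed_image) ?_
    · rintro _ ⟨r, hr, rfl⟩
      exact (hT hr).union_diagRel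
    · rintro _ ⟨i, rfl⟩
      exact ⟨_, hXT ⟨i, rfl⟩, hdiff i⟩
    · rintro _ ⟨r, hr, rfl⟩
      refine ⟨invRel r, hinv r hr, ?_⟩
      ext ⟨x, y⟩
      simp [invRel, diagRel, eq_comm]
  have hpair : ∀ x y : α, ∃ r ∈ T, r ∪ diagRel α = {(x, y)} ∪ diagRel α := fun x y =>
    himage.superset isTranRel_singleton.union_diagRel
  have hoff : ∀ x y : α, x ≠ y → {(x, y)} ∈ T := by
    intro x y hxy
    refine (hgen.mem_of_isEquRel (hc.isEquRel_singleton_mem hinv hpair) ?_ x y).resolve_left hxy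
    rintro _ ⟨i, rfl⟩ ⟨u, v⟩ huv
    refine or_iff_not_imp_left.2 fun hne => ?_
    obtain ⟨r, hr, hrd⟩ := hpair u v
    convert hc.inter_mem (hXT ⟨i, rfl⟩) hr using 1
    apply Subset.antisymm
    · rintro p rfl
      have : (u, v) ∈ r ∪ diagRel α := hrd ▸ Or.inl rfl
      exact ⟨⟨huv, hne⟩, this.resolve_right hne⟩
    · rintro p ⟨hp, hpr⟩
      have : p ∈ ({(u, v)} ∪ diagRel α : Set (α × α)) := hrd ▸ Or.inl hpr
      exact this.resolve_right hp.2
  intro x y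
  rcases eq_or_ne x y with rfl | hxy
  · obtain ⟨y, hyx, -⟩ := Cardinal.exists_ne_ne_of_three_le h3 x x
    obtain ⟨z, hzx, hzy⟩ := Cardinal.exists_ne_ne_of_three_le h3 x y
    exact hc.singleton_loop_mem hoff hyx hzx hzy
  · exact hoff x y hxy
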